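/- Let A be an abelian algebra and θ a nontrivial strongly abelian congruence on A. Let A(θ) be the substructure of A × A with universe {(x,y) | x θ y}, D the diagonal, and Δ the smallest congruence of A(θ) containing D × D. Then the quotient S = A(θ)/Δ has more than one element; equivalently, Δ is not the total relation on A(θ). -/

import Mathlib

namespace UA

/-- An algebraic language: a type of operation symbols with arities. -/
structure Lang where
  F : Type
  arity : F → ℕ

variable {L : Lang}

/-- An interpretation of the language `L` on the carrier `A` (an algebra structure). -/
def Interp (L : Lang) (A : Type) : Type :=
  (f : L.F) → ((Fin (L.arity f)) → A) → A

/-- Terms of the language `L` over a type `X` of variables. -/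
inductive Term (L : Lang) (X : Type) : Type
  | var : X → Term L X
  | app : (f : L.F) → ((Fin (L.arity f)) → Term L X) → Term L X

/-- Realization of a term under an assignment of the variables. -/
def Term.realize {A X : Type} (I : Interp L A) (v : X → A) : Term L X → A
  | .var x => v x
  | .app f ts => I f (fun i => (ts i).realize I v)

/-- Relabelling (substitution of variables) of terms. -/
def Term.relabel {X Y : Type} (g : X → Y) : Term L X → Term L Y
  | .var x => .var (g x)
  | .app f ts => .app f (fun i => (ts i).relabel g)

/-- `p` is a polynomial operation of the algebra `(A, I)` with argument-index type `X`:
it is the realization of a term in variables `X ⊕ Fin m` where the `Fin m` variables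
are evaluated at fixed constants. -/
def IsPolyOp {A X : Type} (I : Interp L A) (p : (X → A) → A) : Prop :=
  ∃ (m : ℕ) (t : Term L (X ⊕ Fin m)) (c : Fin m → A),
    ∀ x : X → A, p x = t.realize I (Sum.elim x c)

/-- A unary polynomial operation. -/
def IsUnaryPolyOp {A : Type} (I : Interp L A) (g : A → A) : Prop :=
  IsPolyOp I (fun x : Fin 1 → A => g (x 0))

/-- `(p, q, r, s)` is a `1,1`-matrix of the algebra `(A, I)`. -/
def Is11Matrix {A : Type} (I : Interp L A) (p q r s : A) : Prop :=
  ∃ (k l : ℕ) (t : ((Fin k ⊕ Fin l) → A) → A), IsPolyOp I t ∧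
    ∃ (a b : Fin k → A) (u v : Fin l → A),
      p = t (Sum.elim a u) ∧ q = t (Sum.elim a v) ∧
      r = t (Sum.elim b u) ∧ s = t (Sum.elim b v)

/-- The algebra is abelian: in every `1,1`-matrix, `p = q` implies `r = s`. -/
def IsAbelian {A : Type} (I : Interp L A) : Prop :=
  ∀ p q r s : A, Is11Matrix I p q r s → p = q → r = s

/-- The algebra is strongly rectangular: in every `1,1`-matrix, `q = r` implies `r = s`. -/
def IsStronglyRectangular {A : Type} (I : Interp L A) : Prop :=
  ∀ p q r s : A, Is11Matrix I p q r s → q = r → r = s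

/-- Strongly abelian = abelian + strongly rectangular. -/
def IsStronglyAbelian {A : Type} (I : Interp L A) : Prop :=
  IsAbelian I ∧ IsStronglyRectangular I

/-- The algebra has a Maltsev polynomial operation. -/
def HasMaltsevPoly {A : Type} (I : Interp L A) : Prop :=
  ∃ mOp : (Fin 3 → A) → A, IsPolyOp I mOp ∧
    ∀ x y : A, mOp ![x, y, y] = x ∧ mOp ![y, y, x] = x

/-- Affine = abelian + has a Maltsev polynomial operation. -/
def IsAffine {A : Type} (I : Interp L A) : Prop :=
  IsAbelian I ∧ HasMaltsevPoly I

/-- The algebra satisfies the identity `e.1 ≈ e.2`. -/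
def Satisfies {A : Type} (I : Interp L A) (e : Term L ℕ × Term L ℕ) : Prop :=
  ∀ v : ℕ → A, e.1.realize I v = e.2.realize I v

/-- Membership in the variety `Mod(E)` axiomatized by the set `E` of identities. -/
def InVariety {A : Type} (E : Set (Term L ℕ × Term L ℕ)) (I : Interp L A) : Prop :=
  ∀ e ∈ E, Satisfies I e

/-- `θ` is a congruence on the algebra `(A, I)`. -/
def IsCong {A : Type} (I : Interp L A) (θ : A → A → Prop) : Prop :=
  Equivalence θ ∧
    ∀ (f : L.F) (a b : Fin (L.arity f) → A),
      (∀ i, θ (a i) (b i)) → θ (I f a) (I f b)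

/-- `(p, q, r, s)` is a `θ`-matrix of the algebra `(A, I)`. -/
def IsThetaMatrix {A : Type} (I : Interp L A) (θ : A → A → Prop) (p q r s : A) : Prop :=
  ∃ (k l : ℕ) (t : ((Fin k ⊕ Fin l) → A) → A), IsPolyOp I t ∧
    ∃ (a b : Fin k → A) (u v : Fin l → A),
      (∀ i, θ (a i) (b i)) ∧ (∀ j, θ (u j) (v j)) ∧
      p = t (Sum.elim a u) ∧ q = t (Sum.elim a v) ∧
      r = t (Sum.elim b u) ∧ s = t (Sum.elim b v)

/-- `θ` is a strongly abelian congruence. -/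
def IsStronglyAbelianCong {A : Type} (I : Interp L A) (θ : A → A → Prop) : Prop :=
  ∀ p q r s : A, IsThetaMatrix I θ p q r s → (p = q → r = s) ∧ (q = r → r = s)

/-- `S` is a subuniverse of the algebra `(A, I)`. -/
def IsSubuniverse {A : Type} (I : Interp L A) (S : Set A) : Prop :=
  ∀ (f : L.F) (a : Fin (L.arity f) → A), (∀ i, a i ∈ S) → I f a ∈ S

/-- The substructure (restricted algebra structure) on a subuniverse. -/
def subInterp {A : Type} (I : Interp L A) (S : Set A) (hS : IsSubuniverse I S) :
    Interp L S :=
  fun f a => ⟨I f (fun i => (a i : A)), hS f _ (fun i => (a i).2)⟩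

/-- The componentwise algebra structure on a product. -/
def prodInterp {ι : Type} {A : ι → Type} (I : ∀ i, Interp L (A i)) :
    Interp L (∀ i, A i) :=
  fun f a i => I i f (fun j => a j i)

/-- The componentwise algebra structure on `A × A`. -/
def pairInterp {A : Type} (I : Interp L A) : Interp L (A × A) :=
  fun f a => (I f (fun i => (a i).1), I f (fun i => (a i).2))

/-- `h` is a homomorphism of `L`-algebras. -/
def IsHom {A B : Type} (I : Interp L A) (J : Interp L B) (h : A → B) : Prop :=
  ∀ (f : L.F) (a : Fin (L.arity f) → A), h (I f a) = J f (fun i => h (a i))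

/-- The induced algebra structure on the quotient by a congruence `ρ`
(well-defined, i.e. independent of the chosen representatives, when `ρ` is a congruence). -/
noncomputable def quotInterp {A : Type} (I : Interp L A) (ρ : A → A → Prop) :
    Interp L (Quot ρ) :=
  fun f a => Quot.mk ρ (I f (fun i => (a i).out))

/-- The subuniverse generated by a subset `G`: the intersection of all
subuniverses containing `G`. -/
def GenSub {A : Type} (I : Interp L A) (G : Set A) : Set A :=
  {x | ∀ S : Set A, IsSubuniverse I S → G ⊆ S → x ∈ S}

theorem genSub_isSubuniverse {A : Type} (I : Interp L A) (G : Set A) :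
    IsSubuniverse I (GenSub I G) :=
  fun f a ha S hS hG => hS f a (fun i => ha i S hS hG)

/-- The smallest congruence containing the pair `(x, y)`: the intersection of all
congruences containing it. -/
def genCong {A : Type} (I : Interp L A) (x y : A) : A → A → Prop :=
  fun w z => ∀ ρ : A → A → Prop, IsCong I ρ → ρ x y → ρ w z

/-- The carrier of `A(θ)`, the graph of `θ` inside `A × A`. -/
abbrev ThetaSub {A : Type} (θ : A → A → Prop) : Type := {z : A × A // θ z.1 z.2}

/-- The substructure `A(θ) ≤ A × A` supported by the graph of `θ`. -/
def thetaSubInterp {A : Type} (I : Interp L A) (θ : A → A → Prop) (hθ : IsCong I θ) :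
    Interp L (ThetaSub θ) :=
  fun f a => ⟨(I f (fun i => (a i).1.1), I f (fun i => (a i).1.2)),
    hθ.2 f _ _ (fun i => (a i).2)⟩

/-- The diagonal element `(c, c)` of `A(θ)`. -/
def diagEl {A : Type} {θ : A → A → Prop} (hrefl : ∀ a : A, θ a a) (c : A) :
    ThetaSub θ := ⟨(c, c), hrefl c⟩

/-- `Δ`: the smallest congruence of `A(θ)` containing `D × D`, where `D` is the
diagonal -- the intersection of all congruences of `A(θ)` containing `D × D`. -/
def DeltaRel {A : Type} (I : Interp L A) (θ : A → A → Prop) (hθ : IsCong I θ) :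
    ThetaSub θ → ThetaSub θ → Prop :=
  fun x y => ∀ ρ : ThetaSub θ → ThetaSub θ → Prop,
    IsCong (thetaSubInterp I θ hθ) ρ →
    (∀ c d : A, ρ (diagEl hθ.1.refl c) (diagEl hθ.1.refl d)) → ρ x y

/-- The quotient algebra `S = A(θ)/Δ`. -/
noncomputable def SInterp {A : Type} (I : Interp L A) (θ : A → A → Prop)
    (hθ : IsCong I θ) : Interp L (Quot (DeltaRel I θ hθ)) :=
  quotInterp (thetaSubInterp I θ hθ) (DeltaRel I θ hθ)

/-- The element `0` of `S = A(θ)/Δ`: the `Δ`-class of a diagonal element. -/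
def zeroS {A : Type} (I : Interp L A) (θ : A → A → Prop) (hθ : IsCong I θ) (d : A) :
    Quot (DeltaRel I θ hθ) :=
  Quot.mk _ (diagEl hθ.1.refl d)

/-- The diagonal of `B × B`. -/
def diagSet (B : Type) : Set (B × B) := {z | z.1 = z.2}

/-- The set of pairs `(u j, v j)`. -/
def pairsSet {B : Type} {l : ℕ} (u v : Fin l → B) : Set (B × B) :=
  {z | ∃ j, z = (u j, v j)}

/-- The carrier of the subalgebra `C ≤ B × B` generated by the diagonal and the
pairs `(u j, v j)`. -/
def CsetOf {L : Lang} {B : Type} (I : Interp L B) {l : ℕ} (u v : Fin l → B) :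
    Set (B × B) :=
  GenSub (pairInterp I) (diagSet B ∪ pairsSet u v)

/-- The subalgebra `C ≤ B × B` generated by the diagonal and the pairs `(u j, v j)`. -/
def CInterpOf {L : Lang} {B : Type} (I : Interp L B) {l : ℕ} (u v : Fin l → B) :
    Interp L (CsetOf I u v) :=
  subInterp (pairInterp I) _ (genSub_isSubuniverse _ _)

/-- Simultaneous substitution of terms for the variables of a term. -/
def Term.subst {X Y : Type} (g : X → Term L Y) : Term L X → Term L Y
  | .var x => g x
  | .app f ts => .app f (fun i => (ts i).subst g)

theorem Term.realize_subst {A X Y : Type} (I : Interp L A) (g : X → Term L Y) (v : Y → A)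
    (t : Term L X) :
    (t.subst g).realize I v = t.realize I (fun x => (g x).realize I v) := by
  induction t with
  | var x => rfl
  | app f ts ih => simp [Term.subst, Term.realize, ih]

theorem Term.realize_relabel {A X Y : Type} (I : Interp L A) (g : X → Y) (v : Y → A)
    (t : Term L X) : (t.relabel g).realize I v = t.realize I (v ∘ g) := by
  induction t with
  | var x => rfl
  | app f ts ih => simp [Term.relabel, Term.realize, ih]

theorem isPolyOp_realize {A X : Type} (I : Interp L A) (t : Term L X) :
    IsPolyOp I (fun x : X → A => t.realize I x) :=
  ⟨0, t.relabel Sum.inl, Fin.elim0, fun x => by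
    rw [Term.realize_relabel, Sum.elim_comp_inl]⟩

/-- The term `t`, evaluated in `A × A` at `a`, takes a value on the diagonal. -/
def DiagAt {A X : Type} (I : Interp L A) (t : Term L X) (a : X → A × A) : Prop :=
  t.realize I (fun x => (a x).1) = t.realize I (fun x => (a x).2)

open Classical in
/-- The syntactic congruence of the diagonal of `A × A`: two pairs are related when no
polynomial translation of `A × A` separates them with respect to the diagonal. -/
def DiagSyntactic {A : Type} (I : Interp L A) (z w : A × A) : Prop :=
  ∀ (X : Type) [Finite X] (t : Term L X) (i : X) (a : X → A × A),
    DiagAt I t (Function.update a i z) ↔ DiagAt I t (Function.update a i w)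

theorem DiagSyntactic.equivalence {A : Type} (I : Interp L A) :
    Equivalence (DiagSyntactic I) where
  refl _ _ _ _ _ _ := Iff.rfl
  symm h X _ t i a := (h X t i a).symm
  trans h h' X _ t i a := (h X t i a).trans (h' X t i a)

theorem DiagSyntactic.diagAt_iff {A X : Type} [Finite X] {I : Interp L A} (t : Term L X)
    {a b : X → A × A} (h : ∀ x, DiagSyntactic I (a x) (b x)) :
    DiagAt I t a ↔ DiagAt I t b := by
  classical
  have := Fintype.ofFinite X
  have key : ∀ s : Finset X, DiagAt I t a ↔ DiagAt I t (s.piecewise b a) := by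
    intro s
    induction s using Finset.induction_on with
    | empty => simp
    | insert i s hi ih =>
      rw [ih, Finset.piecewise_insert]
      have hs := h i X t i (s.piecewise b a)
      have ha : Function.update (s.piecewise b a) i (a i) = s.piecewise b a := by
        rw [← Finset.piecewise_eq_of_notMem s b a hi, Function.update_eq_self]
      rw [ha] at hs
      convert hs
  simpa using key Finset.univ

theorem DiagSyntactic.pairInterp {A : Type} {I : Interp L A} (f : L.F)
    {a b : Fin (L.arity f) → A × A} (h : ∀ i, DiagSyntactic I (a i) (b i)) :
    DiagSyntactic I (pairInterp I f a) (pairInterp I f b) := by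
  classical
  intro X _ t i c
  let g : X → Term L (X ⊕ Fin (L.arity f)) := fun x =>
    if x = i then .app f (fun j => .var (Sum.inr j)) else .var (Sum.inl x)
  have key : ∀ e : Fin (L.arity f) → A × A,
      DiagAt I t (Function.update c i (UA.pairInterp I f e)) ↔
        DiagAt I (t.subst g) (Sum.elim c e) := by
    intro e
    unfold DiagAt
    rw [Term.realize_subst, Term.realize_subst]
    refine Eq.congr (congrArg (t.realize I) ?_) (congrArg (t.realize I) ?_) <;>
    · funext x
      by_cases hx : x = i
      · subst hx
        simp [g, Term.realize, UA.pairInterp]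
      · simp [g, hx, Term.realize]
  have := (key a).trans ((diagAt_iff (t.subst g) (a := Sum.elim c a) (b := Sum.elim c b)
    (Sum.rec (fun _ => (equivalence I).refl _) h)).trans (key b).symm)
  convert this

theorem IsAbelian.diagSyntactic_diag {A : Type} {I : Interp L A} (hA : IsAbelian I) (c d : A) :
    DiagSyntactic I (c, c) (d, d) := by
  classical
  suffices H : ∀ (X : Type) [Finite X] (t : Term L X) (i : X) (a : X → A × A) (c d : A),
      DiagAt I t (Function.update a i (c, c)) → DiagAt I t (Function.update a i (d, d)) by
    intro X _ t i a
    have := Iff.intro (H X t i a c d) (H X t i a d c)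
    convert this
  intro X _ t i a c d h
  obtain ⟨n, ⟨e⟩⟩ := Finite.exists_equiv_fin X
  let g : X → Fin 1 ⊕ Fin n := fun x => if x = i then Sum.inl 0 else Sum.inr (e x)
  have key : ∀ (π : A × A → A) (y : A), π (y, y) = y →
      (t.relabel g).realize I (Sum.elim (fun _ => y) (fun j => π (a (e.symm j)))) =
        t.realize I (fun x => π (Function.update a i (y, y) x)) := by
    intro π y hy
    rw [Term.realize_relabel]
    congr 1
    funext x
    by_cases hx : x = i
    · subst hx
      simp [g, hy]
    · simp [g, hx]
  exact hA _ _ _ _ ⟨1, n, _, isPolyOp_realize I (t.relabel g), fun _ => c, fun _ => d,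
    fun j => (a (e.symm j)).1, fun j => (a (e.symm j)).2,
    (key Prod.fst c rfl).symm, (key Prod.snd c rfl).symm,
    (key Prod.fst d rfl).symm, (key Prod.snd d rfl).symm⟩ h

/-- For an abelian algebra `A` and a nontrivial strongly abelian congruence
`θ`, the quotient `S = A(θ)/Δ` has more than one element; equivalently, `Δ` is not the
total relation on `A(θ)`. -/
theorem statement5 {L : Lang} {A : Type} (I : Interp L A) (hA : IsAbelian I)
    (θ : A → A → Prop) (hθ : IsCong I θ)
    (hnontriv : ∃ x y : A, θ x y ∧ x ≠ y)
    (hsa : IsStronglyAbelianCong I θ) :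
    ∃ z w : ThetaSub θ, ¬ DeltaRel I θ hθ z w := by
  obtain ⟨x, y, hxy, hne⟩ := hnontriv
  refine ⟨diagEl hθ.1.refl x, ⟨(x, y), hxy⟩, fun h => hne ?_⟩
  have hρ := h (fun z w => DiagSyntactic I z.1 w.1)
    ⟨(DiagSyntactic.equivalence I).comap Subtype.val,
      fun f _ _ hab => DiagSyntactic.pairInterp f hab⟩
    hA.diagSyntactic_diag
  simpa [DiagAt, Term.realize, diagEl] using
    hρ Unit (.var ()) () (fun _ => (x, x))

end UA
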